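/- Let k ≥ 2, L ≥ 3, and let T : Π_L → Σ_k be the map constructed from the proper subshift Π_L. If y ∈ Trans(Π_L), then ω_ξ(T(y)) = ω_ξ(y) for each ξ ∈ {d̄, d̲, B*, B_*}, and moreover ω_σ(y) = Π_L ⊊ ω_σ(T(y)). -/

import Mathlib

open Filter Topology MeasureTheory

/-- Upper density of a set of naturals. -/
noncomputable def upperDensity (S : Set ℕ) : ℝ :=
  Filter.limsup (fun n => ((S ∩ Set.Iio n).ncard : ℝ) / n) Filter.atTop

/-- Lower density of a set of naturals. -/
noncomputable def lowerDensity (S : Set ℕ) : ℝ :=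
  Filter.liminf (fun n => ((S ∩ Set.Iio n).ncard : ℝ) / n) Filter.atTop

/-- Banach upper density: limsup over the interval length of the maximal
proportion of `S` in an interval of that length. -/
noncomputable def banachUpperDensity (S : Set ℕ) : ℝ :=
  Filter.limsup (fun N => ⨆ a : ℕ, ((S ∩ Set.Ico a (a + N)).ncard : ℝ) / N) Filter.atTop

/-- Banach lower density. -/
noncomputable def banachLowerDensity (S : Set ℕ) : ℝ :=
  Filter.liminf (fun N => ⨅ a : ℕ, ((S ∩ Set.Ico a (a + N)).ncard : ℝ) / N) Filter.atTop

/-- The shift map on the full shift `Σ_k = {0, …, k-1}^ℕ`. -/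
def shift {k : ℕ} (x : ℕ → Fin k) : ℕ → Fin k := fun n => x (n + 1)

/-- The metric `d(x,y) = Σ_{n ≥ 1} δ(x_n, y_n)/2^n` on `Σ_k` (sequences indexed from `0`). -/
noncomputable def shiftDist {k : ℕ} (x y : ℕ → Fin k) : ℝ :=
  ∑' n : ℕ, if x n = y n then 0 else (1 / 2) ^ (n + 1)

/-- The open ball `B_ε(x)` for the metric `shiftDist`. -/
def sball {k : ℕ} (x : ℕ → Fin k) (ε : ℝ) : Set (ℕ → Fin k) := {y | shiftDist x y < ε}

/-- `N(x, U) = {n ≥ 1 : σ^n(x) ∈ U}`. -/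
def visits {k : ℕ} (x : ℕ → Fin k) (U : Set (ℕ → Fin k)) : Set ℕ :=
  {n | 1 ≤ n ∧ shift^[n] x ∈ U}

/-- A point is recurrent if `N(x, B_ε(x)) ≠ ∅` for every `ε > 0`. -/
def Recurrent {k : ℕ} (x : ℕ → Fin k) : Prop := ∀ ε > (0 : ℝ), (visits x (sball x ε)).Nonempty

/-- A point is Banach recurrent if `N(x, B_ε(x))` has positive Banach upper density
for every `ε > 0`. -/
def BanachRecurrent {k : ℕ} (x : ℕ → Fin k) : Prop :=
  ∀ ε > (0 : ℝ), 0 < banachUpperDensity (visits x (sball x ε))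

/-- Statistical ω-limit set w.r.t. a density notion `ξ`:
`ω_ξ(x) = {y : ξ(N(x, B_ε(y))) > 0 for all ε > 0}`. -/
def statOmega {k : ℕ} (ξ : Set ℕ → ℝ) (x : ℕ → Fin k) : Set (ℕ → Fin k) :=
  {y | ∀ ε > (0 : ℝ), 0 < ξ (visits x (sball y ε))}

/-- The usual ω-limit set of `x` under the shift. -/
def omegaLim {k : ℕ} (x : ℕ → Fin k) : Set (ℕ → Fin k) :=
  {y | ∀ ε > (0 : ℝ), ∀ N : ℕ, ∃ n ≥ N, shift^[n] x ∈ sball y ε}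

/-- Density of a subset of `Σ_k` w.r.t. the metric `shiftDist`. -/
def ShiftDense {k : ℕ} (A : Set (ℕ → Fin k)) : Prop :=
  ∀ x : ℕ → Fin k, ∀ ε > (0 : ℝ), ∃ y ∈ A, shiftDist x y < ε

/-- Closure of a subset of `Σ_k` w.r.t. the metric `shiftDist`. -/
def shiftClosure {k : ℕ} (A : Set (ℕ → Fin k)) : Set (ℕ → Fin k) :=
  {z | ∀ ε > (0 : ℝ), ∃ y ∈ A, shiftDist z y < ε}

/-- `Φ^{(n)}_{xy}(t)`: the proportion of times `0 ≤ i < n` with `d(σ^i x, σ^i y) < t`. -/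
noncomputable def PhiN {k : ℕ} (x y : ℕ → Fin k) (n : ℕ) (t : ℝ) : ℝ :=
  (({i | i < n ∧ shiftDist (shift^[i] x) (shift^[i] y) < t}).ncard : ℝ) / n

/-- A pair is DC1 (distributionally chaotic of type 1) if `Φ_{xy}(s) = 0` for some `s > 0`
and `Φ*_{xy}(t) = 1` for all `t > 0`. -/
def DC1Pair {k : ℕ} (x y : ℕ → Fin k) : Prop :=
  (∃ s > (0 : ℝ), Filter.liminf (fun n => PhiN x y n s) Filter.atTop = 0) ∧
  (∀ t > (0 : ℝ), Filter.limsup (fun n => PhiN x y n t) Filter.atTop = 1)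

/-- A set with at least two points is DC1-scrambled if every pair of distinct points is DC1. -/
def DC1Scrambled {k : ℕ} (S : Set (ℕ → Fin k)) : Prop :=
  S.Nontrivial ∧ ∀ x ∈ S, ∀ y ∈ S, x ≠ y → DC1Pair x y

/-- `strictOrEq true A B` means `A ⊊ B`; `strictOrEq false A B` means `A = B`. -/
def strictOrEq {α : Type*} (b : Bool) (A B : Set α) : Prop := if b then A ⊂ B else A = B

/-- The patterns of (strict ⊊ = `true` / equality = `false`) for the three inclusions
`ω_{B_*} ⊆ ω_{d̲} ⊆ ω_{d̄} ⊆ ω_{B*}` in Cases (1)–(6). -/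
def caseFlags : Fin 6 → Bool × Bool × Bool :=
  ![(true, false, false), (true, false, true), (false, true, false),
    (true, true, false), (false, true, true), (true, true, true)]

/-- `x` satisfies Case (i), i = 1,…,6: the chain
`ω_{B_*}(x) ⊆ ω_{d̲}(x) ⊆ ω_{d̄}(x) ⊆ ω_{B*}(x) = ω_σ(x)` with strictness pattern given by
`caseFlags i`, and the last inclusion an equality. -/
def SatCase {k : ℕ} (i : Fin 6) (x : ℕ → Fin k) : Prop :=
  strictOrEq (caseFlags i).1 (statOmega banachLowerDensity x) (statOmega lowerDensity x) ∧
  strictOrEq (caseFlags i).2.1 (statOmega lowerDensity x) (statOmega upperDensity x) ∧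
  strictOrEq (caseFlags i).2.2 (statOmega upperDensity x) (statOmega banachUpperDensity x) ∧
  statOmega banachUpperDensity x = omegaLim x

/-- `x` satisfies Case (i'), i = 1,…,6: as in Case (i) but the last inclusion
`ω_{B*}(x) ⊆ ω_σ(x)` is strict. -/
def SatCase' {k : ℕ} (i : Fin 6) (x : ℕ → Fin k) : Prop :=
  strictOrEq (caseFlags i).1 (statOmega banachLowerDensity x) (statOmega lowerDensity x) ∧
  strictOrEq (caseFlags i).2.1 (statOmega lowerDensity x) (statOmega upperDensity x) ∧
  strictOrEq (caseFlags i).2.2 (statOmega upperDensity x) (statOmega banachUpperDensity x) ∧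
  statOmega banachUpperDensity x ⊂ omegaLim x
/-- A subshift: a nonempty, closed (w.r.t. the metric `shiftDist`), shift-invariant subset. -/
def IsSubshift {k : ℕ} (P : Set (ℕ → Fin k)) : Prop :=
  P.Nonempty ∧ shiftClosure P ⊆ P ∧ ∀ x ∈ P, shift x ∈ P

/-- The first `n` symbols of `y` as a finite word. -/
def prefixWord {k : ℕ} (y : ℕ → Fin k) (n : ℕ) : List (Fin k) :=
  List.ofFn (fun i : Fin n => y i)

/-- A finite word occurs in (the language of) `P` if it is the initial word of
some point of `P`. -/
def IsWordIn {k : ℕ} (w : List (Fin k)) (P : Set (ℕ → Fin k)) : Prop :=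
  ∃ x ∈ P, ∀ i : Fin w.length, x i = w.get i

/-- Data for the construction of the map `T`: an enumeration `C` of all (nonempty) finite
words of the subshift `P`, and a nonempty finite word `A1` not occurring in `P`. -/
structure TData (k : ℕ) (P : Set (ℕ → Fin k)) where
  C : ℕ → List (Fin k)
  A1 : List (Fin k)
  A1_ne : A1 ≠ []
  A1_not : ¬ IsWordIn A1 P
  C_in : ∀ n, IsWordIn (C n) P
  C_surj : ∀ w : List (Fin k), w ≠ [] → IsWordIn w P → ∃ n, C n = w

/-- The words `A_n` of the construction (indexed from `0`, so `TData.A y 0` is the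
paper's `A_1`): `A_{n+1} = A_n B_n A_n`, where `B_n = C_n Y_n ⋯ Y_n` consists of the
word `C_n` followed by `|A_n|²` copies of the initial word `Y_n` of `y` (paper's `Y_n`,
of length `n`, is `prefixWord y (n+1)` in our `0`-based indexing). -/
def TData.A {k : ℕ} {P : Set (ℕ → Fin k)} (D : TData k P) (y : ℕ → Fin k) :
    ℕ → List (Fin k)
  | 0 => D.A1
  | n + 1 =>
      D.A y n ++
        (D.C n ++ (List.replicate ((D.A y n).length ^ 2) (prefixWord y (n + 1))).flatten) ++
        D.A y n

/-- The requirement `|C_n| = o(|A_n|)` as `n → ∞`. -/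
def TData.Small {k : ℕ} {P : Set (ℕ → Fin k)} (D : TData k P) : Prop :=
  ∀ y : ℕ → Fin k,
    Filter.Tendsto (fun n => ((D.C n).length : ℝ) / ((D.A y n).length))
      Filter.atTop (nhds 0)

/-- The map `T`: `T(y) = lim_n A_n` is the sequence whose `i`-th symbol is the `i`-th
symbol of `A_n` for every large `n` (the words `A_n` are nested prefixes of each other,
and `|A_{i+1}| > i`, so the `i`-th symbol of `A_{i+1}` is well defined). -/
def TData.T {k : ℕ} {P : Set (ℕ → Fin k)} (D : TData k P) (y : ℕ → Fin k) : ℕ → Fin k :=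
  fun i => if h : i < (D.A y (i + 1)).length then (D.A y (i + 1)).get ⟨i, h⟩ else y i
/-- The subshift of finite type `Π_L ⊆ Σ_k`: sequences in which no `L` consecutive
symbols are all equal. -/
def PiL (k L : ℕ) : Set (ℕ → Fin k) :=
  {x | ∀ i : ℕ, ∃ j₁ j₂ : ℕ, j₁ < L ∧ j₂ < L ∧ x (i + j₁) ≠ x (i + j₂)}


section aux
open Classical in
noncomputable def cnt (S : Set ℕ) (a b : ℕ) : ℕ := ((Finset.Ico a b).filter (· ∈ S)).card

lemma cnt_eq (S : Set ℕ) (a b : ℕ) : (S ∩ Set.Ico a b).ncard = cnt S a b := by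
  classical
  unfold cnt
  rw [← Set.ncard_coe_finset]
  congr 1
  ext i
  simp only [Set.mem_inter_iff, Set.mem_Ico, Finset.coe_filter, Finset.mem_Ico, Set.mem_ofPred_eq]
  tauto

lemma cnt_eq0 (S : Set ℕ) (b : ℕ) : (S ∩ Set.Iio b).ncard = cnt S 0 b := by
  rw [← cnt_eq]
  congr 2
  ext i
  simp

lemma cnt_le (S : Set ℕ) (a b : ℕ) : cnt S a b ≤ b - a := by
  classical
  unfold cnt
  refine (Finset.card_filter_le _ _).trans ?_
  simp

lemma cnt_mono {S S' : Set ℕ} (h : S ⊆ S') (a b : ℕ) : cnt S a b ≤ cnt S' a b := by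
  classical
  unfold cnt
  apply Finset.card_le_card
  intro i hi
  rw [Finset.mem_filter] at hi ⊢
  exact ⟨hi.1, h hi.2⟩

lemma cnt_add (S : Set ℕ) {a b c : ℕ} (hab : a ≤ b) (hbc : b ≤ c) :
    cnt S a c = cnt S a b + cnt S b c := by
  classical
  unfold cnt
  rw [← Finset.card_union_of_disjoint, ← Finset.filter_union, Finset.Ico_union_Ico_eq_Ico hab hbc]
  apply Finset.disjoint_filter_filter
  exact Finset.Ico_disjoint_Ico_consecutive a b c

lemma ratio_bd (S : Set ℕ) (a N : ℕ) :
    0 ≤ ((cnt S a (a + N) : ℕ) : ℝ) / N ∧ ((cnt S a (a + N) : ℕ) : ℝ) / N ≤ 1 := by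
  refine ⟨by positivity, ?_⟩
  have h := cnt_le S a (a + N)
  apply div_le_one_of_le₀ _ (by positivity)
  exact_mod_cast (by omega)

lemma upper_eq (S : Set ℕ) :
    upperDensity S = Filter.limsup (fun n : ℕ => ((cnt S 0 n : ℕ) : ℝ) / n) Filter.atTop := by
  unfold upperDensity; simp only [cnt_eq0]

lemma lower_eq (S : Set ℕ) :
    lowerDensity S = Filter.liminf (fun n : ℕ => ((cnt S 0 n : ℕ) : ℝ) / n) Filter.atTop := by
  unfold lowerDensity; simp only [cnt_eq0]

lemma ratio_bd0 (S : Set ℕ) (N : ℕ) :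
    0 ≤ ((cnt S 0 N : ℕ) : ℝ) / N ∧ ((cnt S 0 N : ℕ) : ℝ) / N ≤ 1 := by
  simpa using ratio_bd S 0 N

lemma lim_mono {u v : ℕ → ℝ} (hu : ∀ n, 0 ≤ u n ∧ u n ≤ 1) (hv : ∀ n, 0 ≤ v n ∧ v n ≤ 1)
    (h : ∀ n, u n ≤ v n) : limsup u atTop ≤ limsup v atTop ∧ liminf u atTop ≤ liminf v atTop := by
  have bu : IsBoundedUnder (· ≤ ·) atTop u := isBoundedUnder_of ⟨1, fun n => (hu n).2⟩
  have bu' : IsBoundedUnder (· ≥ ·) atTop u := isBoundedUnder_of ⟨0, fun n => (hu n).1⟩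
  have bv : IsBoundedUnder (· ≤ ·) atTop v := isBoundedUnder_of ⟨1, fun n => (hv n).2⟩
  have bv' : IsBoundedUnder (· ≥ ·) atTop v := isBoundedUnder_of ⟨0, fun n => (hv n).1⟩
  exact ⟨limsup_le_limsup (Eventually.of_forall h) bu'.isCoboundedUnder_le bv,
    liminf_le_liminf (Eventually.of_forall h) bu' bv.isCoboundedUnder_ge⟩

lemma lim_transfer {u v : ℕ → ℝ} (hu : ∀ n, 0 ≤ u n ∧ u n ≤ 1) (hv : ∀ n, 0 ≤ v n ∧ v n ≤ 1)
    {φ : ℕ → ℕ} (hφ : Tendsto φ atTop atTop)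
    (h : Tendsto (fun n => u n - v (φ n)) atTop (𝓝 0)) :
    limsup u atTop ≤ limsup v atTop ∧ liminf v atTop ≤ liminf u atTop := by
  have bu : IsBoundedUnder (· ≤ ·) atTop u := isBoundedUnder_of ⟨1, fun n => (hu n).2⟩
  have bu' : IsBoundedUnder (· ≥ ·) atTop u := isBoundedUnder_of ⟨0, fun n => (hu n).1⟩
  have bv : IsBoundedUnder (· ≤ ·) atTop v := isBoundedUnder_of ⟨1, fun n => (hv n).2⟩
  have bv' : IsBoundedUnder (· ≥ ·) atTop v := isBoundedUnder_of ⟨0, fun n => (hv n).1⟩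
  constructor
  · apply le_of_forall_pos_le_add
    intro ε hε
    apply limsup_le_of_le bu'.isCoboundedUnder_le
    have h1 : ∀ᶠ n in atTop, v n < limsup v atTop + ε / 2 :=
      eventually_lt_of_limsup_lt (by linarith) bv
    have h2 := hφ.eventually h1
    have h3 := h.eventually (gt_mem_nhds (show (0 : ℝ) < ε / 2 by linarith))
    filter_upwards [h2, h3] with n a b
    linarith
  · apply le_of_forall_pos_le_add
    intro ε hε
    rw [← sub_le_iff_le_add]
    apply le_liminf_of_le bu.isCoboundedUnder_ge
    have h1 : ∀ᶠ n in atTop, liminf v atTop - ε / 2 < v n :=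
      eventually_lt_of_lt_liminf (by linarith) bv'
    have h2 := hφ.eventually h1
    have h3 := h.eventually (lt_mem_nhds (show -(ε / 2) < (0 : ℝ) by linarith))
    filter_upwards [h2, h3] with n a b
    linarith

lemma bsup_bd (S : Set ℕ) (N : ℕ) :
    0 ≤ (⨆ a : ℕ, ((cnt S a (a + N) : ℕ) : ℝ) / N) ∧
      (⨆ a : ℕ, ((cnt S a (a + N) : ℕ) : ℝ) / N) ≤ 1 :=
  ⟨Real.iSup_nonneg fun a => (ratio_bd S a N).1, ciSup_le fun a => (ratio_bd S a N).2⟩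

lemma bsup_bdd (S : Set ℕ) (N : ℕ) :
    BddAbove (Set.range fun a : ℕ => ((cnt S a (a + N) : ℕ) : ℝ) / N) :=
  ⟨1, by rintro _ ⟨a, rfl⟩; exact (ratio_bd S a N).2⟩

lemma binf_bdd (S : Set ℕ) (N : ℕ) :
    BddBelow (Set.range fun a : ℕ => ((cnt S a (a + N) : ℕ) : ℝ) / N) :=
  ⟨0, by rintro _ ⟨a, rfl⟩; exact (ratio_bd S a N).1⟩

lemma binf_bd (S : Set ℕ) (N : ℕ) :
    0 ≤ (⨅ a : ℕ, ((cnt S a (a + N) : ℕ) : ℝ) / N) ∧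
      (⨅ a : ℕ, ((cnt S a (a + N) : ℕ) : ℝ) / N) ≤ 1 :=
  ⟨Real.iInf_nonneg fun a => (ratio_bd S a N).1,
    (ciInf_le (binf_bdd S N) 0).trans (ratio_bd S 0 N).2⟩

lemma bupper_eq (S : Set ℕ) : banachUpperDensity S =
    Filter.limsup (fun N : ℕ => ⨆ a : ℕ, ((cnt S a (a + N) : ℕ) : ℝ) / N) Filter.atTop := by
  unfold banachUpperDensity; simp only [cnt_eq]

lemma blower_eq (S : Set ℕ) : banachLowerDensity S =
    Filter.liminf (fun N : ℕ => ⨅ a : ℕ, ((cnt S a (a + N) : ℕ) : ℝ) / N) Filter.atTop := by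
  unfold banachLowerDensity; simp only [cnt_eq]

lemma ratio_mono {S S' : Set ℕ} (h : S ⊆ S') (a b N : ℕ) :
    ((cnt S a b : ℕ) : ℝ) / N ≤ ((cnt S' a b : ℕ) : ℝ) / N := by
  have := cnt_mono h a b
  gcongr

lemma upper_mono : Monotone upperDensity := fun S S' h => by
  rw [upper_eq, upper_eq]
  exact (lim_mono (ratio_bd0 S) (ratio_bd0 S') fun n => ratio_mono h _ _ _).1

lemma lower_mono : Monotone lowerDensity := fun S S' h => by
  rw [lower_eq, lower_eq]
  exact (lim_mono (ratio_bd0 S) (ratio_bd0 S') fun n => ratio_mono h _ _ _).2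

lemma bupper_mono : Monotone banachUpperDensity := fun S S' h => by
  rw [bupper_eq, bupper_eq]
  exact (lim_mono (bsup_bd S) (bsup_bd S') fun n =>
    ciSup_mono (bsup_bdd S' n) fun a => ratio_mono h _ _ _).1

lemma blower_mono : Monotone banachLowerDensity := fun S S' h => by
  rw [blower_eq, blower_eq]
  exact (lim_mono (binf_bd S) (binf_bd S') fun n =>
    ciInf_mono (binf_bdd S n) fun a => ratio_mono h _ _ _).2

/-! cylinders -/
variable {k : ℕ}

lemma shift_iter (x : ℕ → Fin k) (n i : ℕ) : shift^[n] x i = x (n + i) := by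
  induction n generalizing x i with
  | zero => simp
  | succ n ih =>
    rw [Function.iterate_succ_apply, ih]
    unfold shift
    congr 1; ring

lemma sd_summable (x z : ℕ → Fin k) :
    Summable (fun n : ℕ => if x n = z n then (0 : ℝ) else (1 / 2) ^ (n + 1)) := by
  apply Summable.of_nonneg_of_le (f := fun n : ℕ => (1 / 2 : ℝ) ^ (n + 1))
  · intro n; split_ifs <;> positivity
  · intro n; split_ifs
    · positivity
    · exact le_rfl
  · exact (summable_nat_add_iff 1).2 summable_geometric_two

lemma agree_of_sd {x z : ℕ → Fin k} {m : ℕ} (h : shiftDist x z < (1 / 2) ^ m) :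
    ∀ i < m, x i = z i := by
  intro i hi
  by_contra hne
  have h1 : (if x i = z i then (0 : ℝ) else (1 / 2) ^ (i + 1)) ≤ shiftDist x z := by
    unfold shiftDist
    apply (sd_summable x z).le_tsum i
    intro j _; split_ifs <;> positivity
  rw [if_neg hne] at h1
  have h2 : (1 / 2 : ℝ) ^ m ≤ (1 / 2) ^ (i + 1) :=
    pow_le_pow_of_le_one (by norm_num) (by norm_num) hi
  linarith

lemma sd_of_agree {x z : ℕ → Fin k} {m : ℕ} (h : ∀ i < m, x i = z i) :
    shiftDist x z ≤ (1 / 2) ^ m := by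
  unfold shiftDist
  rw [← (sd_summable x z).sum_add_tsum_nat_add m]
  rw [Finset.sum_eq_zero (by intro i hi; rw [if_pos (h i (Finset.mem_range.1 hi))]), zero_add]
  have hs : HasSum (fun n : ℕ => (1 / 2 : ℝ) ^ m * ((1 / 2) / 2 ^ n)) ((1 / 2) ^ m * 1) := by
    apply HasSum.mul_left
    have := hasSum_geometric_two' (1 : ℝ)
    simpa using this
  rw [mul_one] at hs
  rw [← hs.tsum_eq]
  apply Summable.tsum_le_tsum _ ((summable_nat_add_iff m).2 (sd_summable x z)) hs.summable
  intro n
  split_ifs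
  · positivity
  · apply le_of_eq
    rw [pow_add, pow_add, one_div_pow, one_div_pow]; field_simp

def occ (x z : ℕ → Fin k) (m : ℕ) : Set ℕ := {n | 1 ≤ n ∧ ∀ i < m, x (n + i) = z i}

lemma occ_anti (x z : ℕ → Fin k) {m m' : ℕ} (h : m ≤ m') : occ x z m' ⊆ occ x z m :=
  fun _ hn => ⟨hn.1, fun i hi => hn.2 i (by omega)⟩

lemma exists_half_pow {ε : ℝ} (h : 0 < ε) : ∃ m : ℕ, (1 / 2 : ℝ) ^ m < ε :=
  exists_pow_lt_of_lt_one h (by norm_num)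

lemma statOmega_iff {ξ : Set ℕ → ℝ} (hξ : Monotone ξ) (x z : ℕ → Fin k) :
    z ∈ statOmega ξ x ↔ ∀ m, 0 < ξ (occ x z m) := by
  constructor
  · intro h m
    refine (h ((1 / 2) ^ m) (by positivity)).trans_le (hξ ?_)
    rintro n ⟨h1, h2⟩
    refine ⟨h1, fun i hi => ?_⟩
    rw [← shift_iter x n i]
    exact (agree_of_sd h2 i hi).symm
  · intro h ε hε
    obtain ⟨m, hm⟩ := exists_half_pow hε
    refine (h m).trans_le (hξ ?_)
    rintro n ⟨h1, h2⟩
    refine ⟨h1, ?_⟩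
    refine (sd_of_agree (m := m) ?_).trans_lt hm
    intro i hi
    rw [shift_iter]; exact (h2 i hi).symm

lemma omegaLim_iff (x z : ℕ → Fin k) :
    z ∈ omegaLim x ↔ ∀ m N, ∃ n ≥ N, ∀ i < m, x (n + i) = z i := by
  constructor
  · intro h m N
    obtain ⟨n, hn, h2⟩ := h ((1 / 2) ^ m) (by positivity) N
    refine ⟨n, hn, fun i hi => ?_⟩
    rw [← shift_iter x n i]
    exact (agree_of_sd h2 i hi).symm
  · intro h ε hε N
    obtain ⟨m, hm⟩ := exists_half_pow hε
    obtain ⟨n, hn, h2⟩ := h m N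
    refine ⟨n, hn, ?_⟩
    refine (sd_of_agree (m := m) ?_).trans_lt hm
    intro i hi
    rw [shift_iter]; exact (h2 i hi).symm

/-! Banach part, generic -/

lemma exists_ne_fin (hk : 2 ≤ k) (b : Fin k) : ∃ b' : Fin k, b' ≠ b := by
  have : Nontrivial (Fin k) := Fin.nontrivial_iff_two_le.2 hk
  exact exists_ne b

lemma exists_periodic {L : ℕ} (hk : 2 ≤ k) (hL : 3 ≤ L) (z : ℕ → Fin k) (hz : z ∈ PiL k L)
    (m : ℕ) : ∃ v ∈ PiL k L, ∀ q i, i < m + 1 → v (q * (m + 3) + i) = z i := by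
  obtain ⟨b, hb⟩ := exists_ne_fin hk (z m)
  obtain ⟨a, ha⟩ := exists_ne_fin hk (z 0)
  let g : ℕ → Fin k := fun r => if r < m + 1 then z r else if r = m + 1 then b else a
  let v : ℕ → Fin k := fun i => g (i % (m + 3))
  have hv : ∀ q r, r < m + 3 → v (q * (m + 3) + r) = g r := by
    intro q r hr
    simp only [v]
    rw [Nat.mul_add_mod', Nat.mod_eq_of_lt hr]
  have hv' : ∀ q r, r < m + 1 → v (q * (m + 3) + r) = z r := by
    intro q r hr
    rw [hv q r (by omega)]
    simp only [g, if_pos hr]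
  refine ⟨v, ?_, hv'⟩
  intro i
  obtain ⟨q, r, hr, rfl⟩ : ∃ q r, r < m + 3 ∧ i = q * (m + 3) + r :=
    ⟨i / (m + 3), i % (m + 3), Nat.mod_lt _ (by omega), (Nat.div_add_mod' _ _).symm⟩
  have hvb : v (q * (m + 3) + (m + 1)) = b := by
    rw [hv q _ (by omega)]; simp [g]
  have hva : v (q * (m + 3) + (m + 2)) = a := by
    rw [hv q _ (by omega)]; simp [g]
  have hv0 : v (q * (m + 3) + (m + 3)) = z 0 := by
    have := hv' (q + 1) 0 (by omega)
    rw [← this]; congr 1; ring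
  have hvm := hv' q m (by omega)
  by_cases h1 : r + L ≤ m + 1
  · obtain ⟨j₁, j₂, h₁, h₂, hne⟩ := hz r
    refine ⟨j₁, j₂, h₁, h₂, ?_⟩
    rw [add_assoc, add_assoc, hv' q _ (by omega), hv' q _ (by omega)]
    exact hne
  by_cases h2 : r < m + 1
  · refine ⟨m - r, m + 1 - r, by omega, by omega, ?_⟩
    rw [add_assoc, add_assoc, show r + (m - r) = m by omega, show r + (m + 1 - r) = m + 1 by omega,
      hvb, hvm]
    exact hb.symm
  · refine ⟨m + 2 - r, m + 3 - r, by omega, by omega, ?_⟩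
    rw [add_assoc, add_assoc, show r + (m + 2 - r) = m + 2 by omega,
      show r + (m + 3 - r) = m + 3 by omega, hva, hv0]
    exact ha

lemma le_cnt_of_inj (S : Set ℕ) (a b J : ℕ) (f : ℕ → ℕ) (hf : Function.Injective f)
    (h : ∀ j < J, f j ∈ S ∧ a ≤ f j ∧ f j < b) : J ≤ cnt S a b := by
  classical
  unfold cnt
  calc J = ((Finset.range J).image f).card := by
        rw [Finset.card_image_of_injective _ hf, Finset.card_range]
    _ ≤ _ := by
        apply Finset.card_le_card
        intro p hp
        obtain ⟨j, hj, rfl⟩ := Finset.mem_image.1 hp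
        obtain ⟨h1, h2, h3⟩ := h j (Finset.mem_range.1 hj)
        rw [Finset.mem_filter, Finset.mem_Ico]
        exact ⟨⟨h2, h3⟩, h1⟩

lemma PiL_subset_bupper {L : ℕ} (hk : 2 ≤ k) (hL : 3 ≤ L) (u : ℕ → Fin k)
    (hu : PiL k L ⊆ omegaLim u) : PiL k L ⊆ statOmega banachUpperDensity u := by
  intro z hz
  rw [statOmega_iff bupper_mono]
  intro m
  obtain ⟨v, hv, hvz⟩ := exists_periodic hk hL z hz m
  have hv' := (omegaLim_iff u v).1 (hu hv)
  refine lt_of_lt_of_le ?_ (bupper_mono (occ_anti u z (Nat.le_succ m)))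
  rw [bupper_eq]
  set S := occ u z (m + 1)
  have key : ∀ᶠ N : ℕ in atTop, (1 : ℝ) / (2 * (m + 3)) ≤
      ⨆ a : ℕ, ((cnt S a (a + N) : ℕ) : ℝ) / N := by
    filter_upwards [eventually_ge_atTop (m + 3)] with N hN
    obtain ⟨n, hn, hn'⟩ := hv' (N + m + 1) 1
    refine le_trans ?_ (le_ciSup (bsup_bdd S N) n)
    have h1 : N / (m + 3) ≤ cnt S n (n + N) := by
      apply le_cnt_of_inj S _ _ _ (fun q => n + q * (m + 3))
      · intro q q' h
        have h' : q * (m + 3) = q' * (m + 3) := by simpa using h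
        exact Nat.eq_of_mul_eq_mul_right (by omega) h'
      · intro q hq
        have h3 : (q + 1) * (m + 3) ≤ N :=
          (Nat.mul_le_mul_right _ hq).trans (Nat.div_mul_le_self _ _)
        have h4 : q * (m + 3) + (m + 3) ≤ N := by linarith [add_mul q 1 (m + 3)]
        refine ⟨⟨by omega, fun i hi => ?_⟩, by omega, by omega⟩
        rw [add_assoc, hn' _ (by omega), hvz q i hi]
    have h2 : N < 2 * (m + 3) * (N / (m + 3)) := by
      have h5 := Nat.div_add_mod N (m + 3)
      have h6 := Nat.mod_lt N (show 0 < m + 3 by omega)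
      have h7 : 1 ≤ N / (m + 3) := (Nat.one_le_div_iff (by omega)).2 hN
      nlinarith
    rw [div_le_div_iff₀ (by positivity) (by exact_mod_cast (by omega : 0 < N))]
    have h8 : N ≤ cnt S n (n + N) * (2 * (m + 3)) := by nlinarith
    rw [one_mul]
    exact_mod_cast h8
  refine lt_of_lt_of_le (show (0 : ℝ) < 1 / (2 * (m + 3)) by positivity) ?_
  exact le_limsup_of_frequently_le key.frequently
    (isBoundedUnder_of ⟨1, fun n => (bsup_bd S n).2⟩)

lemma cnt_pos {S : Set ℕ} {a b : ℕ} (h : 0 < cnt S a b) : ∃ p ∈ S, a ≤ p ∧ p < b := by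
  classical
  unfold cnt at h
  obtain ⟨p, hp⟩ := Finset.card_pos.1 h
  rw [Finset.mem_filter, Finset.mem_Ico] at hp
  exact ⟨p, hp.2, hp.1.1, hp.1.2⟩

lemma blower_empty {L : ℕ} (hk : 2 ≤ k) (hL : 3 ≤ L) (u : ℕ → Fin k)
    (hu : PiL k L ⊆ omegaLim u) : statOmega banachLowerDensity u = ∅ := by
  rw [Set.eq_empty_iff_forall_notMem]
  intro z hz
  rw [statOmega_iff blower_mono] at hz
  have h3 := hz 3
  rw [blower_eq] at h3
  set S := occ u z 3 with hS
  obtain ⟨N, hN⟩ : ∃ N : ℕ, 0 < ⨅ a : ℕ, ((cnt S a (a + N) : ℕ) : ℝ) / N := by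
    have := eventually_lt_of_lt_liminf h3 (isBoundedUnder_of ⟨0, fun n => (binf_bd S n).1⟩)
    exact this.exists
  have hall : ∀ a, ∃ p ∈ S, a ≤ p ∧ p < a + N := by
    intro a
    apply cnt_pos
    have h1 : 0 < ((cnt S a (a + N) : ℕ) : ℝ) / N := hN.trans_le (ciInf_le (binf_bdd S N) a)
    by_contra h0
    have h0' : cnt S a (a + N) = 0 := by omega
    rw [h0'] at h1
    simp at h1
  have hword : ∀ v ∈ PiL k L, ∃ p, ∀ i < 3, v (p + i) = z i := by
    intro v hv
    obtain ⟨n, -, hn⟩ := (omegaLim_iff u v).1 (hu hv) (N + 3) 0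
    obtain ⟨p, hp, h1, h2⟩ := hall n
    refine ⟨p - n, fun i hi => ?_⟩
    rw [← hn _ (by omega), ← hp.2 i hi]
    congr 1; omega
  let e0 : Fin k := ⟨0, by omega⟩
  let e1 : Fin k := ⟨1, by omega⟩
  have hne : e0 ≠ e1 := by simp [e0, e1]
  obtain ⟨p, hp⟩ := hword (fun i => if i % 2 = 0 then e0 else e1) (by
    intro i
    refine ⟨0, 1, by omega, by omega, ?_⟩
    rcases Nat.mod_two_eq_zero_or_one i with h | h
    · have : (i + 1) % 2 = 1 := by omega
      simp [h, this, hne]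
    · have : (i + 1) % 2 = 0 := by omega
      simp [h, this, hne.symm])
  have hz02 : z 0 = z 2 := by
    rw [← hp 0 (by omega), ← hp 2 (by omega)]
    simp
  have h4 : ∀ i, (fun i : ℕ => if i % 4 < 2 then e0 else e1) i ≠
      (fun i : ℕ => if i % 4 < 2 then e0 else e1) (i + 2) := by
    intro i
    by_cases h : i % 4 < 2
    · have : ¬ ((i + 2) % 4 < 2) := by omega
      simp only [if_pos h, if_neg this]; exact hne
    · have : ((i + 2) % 4 < 2) := by omega
      simp only [if_neg h, if_pos this]; exact hne.symm
  obtain ⟨p, hp⟩ := hword (fun i => if i % 4 < 2 then e0 else e1) (by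
    intro i
    exact ⟨0, 2, by omega, by omega, h4 i⟩)
  apply h4 p
  exact (hp 0 (by omega)).trans (hz02.trans (hp 2 (by omega)).symm)

/-! structure of T y -/

structure Str (L : ℕ) (x y : ℕ → Fin k) (a c : ℕ → ℕ) : Prop where
  apos : ∀ n, 1 ≤ a n
  asucc : ∀ n, a (n + 1) = a n + (c n + a n ^ 2 * (n + 1)) + a n
  hC : ∀ n, ∃ v ∈ PiL k L, ∀ i < c n, x (a n + i) = v i
  hY : ∀ n j i, j < a n ^ 2 → i < n + 1 → x (a n + c n + j * (n + 1) + i) = y i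
  hA : ∀ n i, i < a n → x (a n + (c n + a n ^ 2 * (n + 1)) + i) = x i

lemma prefix_len (y : ℕ → Fin k) (n : ℕ) : (prefixWord y n).length = n := by
  simp [prefixWord]

lemma prefix_get (y : ℕ → Fin k) (n i : ℕ) (h : i < n) : (prefixWord y n)[i]? = some (y i) := by
  unfold prefixWord
  rw [List.getElem?_eq_getElem (by simpa using h), List.getElem_ofFn]

lemma flat_len (w : List (Fin k)) (j : ℕ) :
    (List.replicate j w).flatten.length = j * w.length := by
  simp [List.length_flatten]

lemma flat_get (w : List (Fin k)) : ∀ (J j i : ℕ), j < J → i < w.length →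
    (List.replicate J w).flatten[j * w.length + i]? = w[i]? := by
  intro J
  induction J with
  | zero => intro j i h; omega
  | succ J ih =>
    intro j i hj hi
    rw [List.replicate_succ, List.flatten_cons]
    cases j with
    | zero => rw [List.getElem?_append_left (by omega)]; congr 1; omega
    | succ j =>
      have e : (j + 1) * w.length + i = w.length + (j * w.length + i) := by ring
      rw [e, List.getElem?_append_right (by omega), Nat.add_sub_cancel_left]
      exact ih j i (by omega) hi

lemma A_len {P : Set (ℕ → Fin k)} (D : TData k P) (y : ℕ → Fin k) (n : ℕ) :
    (D.A y (n + 1)).length = (D.A y n).length +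
      ((D.C n).length + (D.A y n).length ^ 2 * (n + 1)) + (D.A y n).length := by
  rw [TData.A, List.length_append, List.length_append, List.length_append, flat_len, prefix_len]

lemma A_pos {P : Set (ℕ → Fin k)} (D : TData k P) (y : ℕ → Fin k) (n : ℕ) :
    n + 1 ≤ (D.A y n).length := by
  induction n with
  | zero => exact List.length_pos_iff.2 D.A1_ne
  | succ n ih => rw [A_len]; omega

lemma A_prefix {P : Set (ℕ → Fin k)} (D : TData k P) (y : ℕ → Fin k) {n n' : ℕ} (h : n ≤ n') :
    D.A y n <+: D.A y n' := by
  induction n', h using Nat.le_induction with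
  | base => exact List.prefix_rfl
  | succ m _ ih =>
    refine ih.trans ?_
    rw [TData.A, List.append_assoc]
    exact List.prefix_append _ _

lemma T_get {P : Set (ℕ → Fin k)} (D : TData k P) (y : ℕ → Fin k) (n i : ℕ)
    (hi : i < (D.A y n).length) : (D.A y n)[i]? = some (D.T y i) := by
  have h1 : i < (D.A y (i + 1)).length := by have := A_pos D y (i + 1); omega
  have h2 : (D.A y (i + 1))[i]? = some (D.T y i) := by
    unfold TData.T
    rw [dif_pos h1]; simp
  rw [← h2]
  rcases le_total n (i + 1) with h | h
  · obtain ⟨t, ht⟩ := A_prefix D y h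
    rw [← ht, List.getElem?_append_left hi]
  · obtain ⟨t, ht⟩ := A_prefix D y h
    rw [← ht, List.getElem?_append_left h1]

lemma T_str {L : ℕ} (D : TData k (PiL k L)) (y : ℕ → Fin k) :
    Str L (D.T y) y (fun n => (D.A y n).length) (fun n => (D.C n).length) where
  apos n := by have := A_pos D y n; show 1 ≤ (D.A y n).length; omega
  asucc n := A_len D y n
  hC n := by
    obtain ⟨v, hv, h⟩ := D.C_in n
    refine ⟨v, hv, fun i hi => ?_⟩
    have hi' : i < (D.C n).length := hi
    have h1 := T_get D y (n + 1) ((D.A y n).length + i) (by rw [A_len]; omega)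
    rw [TData.A, List.append_assoc, List.getElem?_append_right (by omega), Nat.add_sub_cancel_left,
      List.append_assoc, List.getElem?_append_left hi] at h1
    have h2 := h ⟨i, hi⟩
    simp only [List.get_eq_getElem] at h2
    rw [h2]
    rw [List.getElem?_eq_getElem hi'] at h1
    exact (Option.some.inj h1).symm
  hY n j i hj hi := by
    have hj' : j < (D.A y n).length ^ 2 := hj
    have hlt : j * (n + 1) + i < (D.A y n).length ^ 2 * (n + 1) := by
      calc j * (n + 1) + i < (j + 1) * (n + 1) := by rw [add_mul]; omega
        _ ≤ _ := Nat.mul_le_mul_right _ hj'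
    have h1 := T_get D y (n + 1) ((D.A y n).length + ((D.C n).length + (j * (n + 1) + i)))
      (by rw [A_len]; omega)
    rw [TData.A, List.append_assoc, List.getElem?_append_right (by omega), Nat.add_sub_cancel_left,
      List.append_assoc, List.getElem?_append_right (by omega), Nat.add_sub_cancel_left,
      List.getElem?_append_left (by rw [flat_len, prefix_len]; exact hlt)] at h1
    have h2 := flat_get (prefixWord y (n + 1)) _ j i hj' (by rw [prefix_len]; exact hi)
    rw [prefix_len] at h2
    rw [h2] at h1
    have h3 := prefix_get y (n + 1) i hi
    rw [h3] at h1
    rw [Option.some.inj h1]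
    congr 1
    ring
  hA n i hi := by
    have hi' : i < (D.A y n).length := hi
    have h1 := T_get D y (n + 1) ((D.A y n).length +
      ((D.C n).length + (D.A y n).length ^ 2 * (n + 1)) + i) (by rw [A_len]; omega)
    rw [TData.A, List.getElem?_append_right
      (by simp only [List.length_append, flat_len, prefix_len]; omega)] at h1
    simp only [List.length_append, flat_len, prefix_len, Nat.add_sub_cancel_left] at h1
    rw [T_get D y n i hi'] at h1
    exact (Option.some.inj h1).symm

lemma T_not_mem {L : ℕ} (D : TData k (PiL k L)) (y : ℕ → Fin k) : D.T y ∉ PiL k L := by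
  intro h
  apply D.A1_not
  refine ⟨_, h, fun i => ?_⟩
  have := T_get D y 0 i i.2
  rw [TData.A, List.getElem?_eq_getElem i.2] at this
  simpa using (Option.some.inj this).symm

lemma recur {L : ℕ} {x y : ℕ → Fin k} {a c : ℕ → ℕ} (h : Str L x y a c) (m N : ℕ) :
    ∃ n ≥ N, ∀ i < m, x (n + i) = x i := by
  have ha : ∀ n, n + 1 ≤ a n := by
    intro n
    induction n with
    | zero => exact h.apos 0
    | succ n ih => rw [h.asucc]; omega
  refine ⟨_, ?_, fun i hi => h.hA (m + N) i ?_⟩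
  · have := ha (m + N); omega
  · have := ha (m + N); omega

lemma T_word {L : ℕ} (D : TData k (PiL k L)) (y v : ℕ → Fin k) (hv : v ∈ PiL k L) (m : ℕ) :
    ∃ p, ∀ i < m, D.T y (p + i) = v i := by
  obtain ⟨n, hn⟩ := D.C_surj (prefixWord v (m + 1)) (by
    intro h; have := congrArg List.length h; rw [prefix_len] at this; simp at this)
    ⟨v, hv, fun i => by
      have h1 := prefix_get v (m + 1) i (i.2.trans_eq (prefix_len v (m + 1)))
      rw [List.getElem?_eq_getElem i.2] at h1
      exact (Option.some.inj h1).symm⟩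
  refine ⟨(D.A y n).length, fun i hi => ?_⟩
  have hl : (D.C n).length = m + 1 := by rw [hn, prefix_len]
  have h1 := T_get D y (n + 1) ((D.A y n).length + i) (by rw [A_len]; omega)
  rw [TData.A, List.append_assoc, List.getElem?_append_right (by omega), Nat.add_sub_cancel_left,
    List.append_assoc, List.getElem?_append_left (by omega), hn,
    prefix_get _ _ _ (by omega)] at h1
  exact (Option.some.inj h1).symm

lemma T_omega {L : ℕ} (D : TData k (PiL k L)) (y : ℕ → Fin k) :
    PiL k L ⊂ omegaLim (D.T y) := by
  refine ⟨?_, fun h => T_not_mem D y (h ?_)⟩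
  · intro v hv
    rw [omegaLim_iff]
    intro m N
    obtain ⟨p, hp⟩ := T_word D y v hv m
    obtain ⟨n, hn, h⟩ := recur (T_str D y) (p + m) N
    refine ⟨n + p, by omega, fun i hi => ?_⟩
    rw [add_assoc, h _ (by omega), hp i hi]
  · rw [omegaLim_iff]
    exact fun m N => recur (T_str D y) m N

/-! Banach upper bound -/

def badSet (L : ℕ) (x : ℕ → Fin k) (t : ℕ) : Set ℕ := {p | p + L ≤ t ∧ ∀ j < L, x (p + j) = x p}

noncomputable def inn (L : ℕ) (x : ℕ → Fin k) (s t : ℕ) : ℕ := cnt (badSet L x t) s t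

lemma inn_le (L : ℕ) (x : ℕ → Fin k) (s t : ℕ) : inn L x s t ≤ t - s := cnt_le _ _ _

lemma inn_split (L : ℕ) (x : ℕ → Fin k) (s r t : ℕ) (_ : s ≤ r) (_ : r ≤ t) :
    inn L x s t ≤ inn L x s r + inn L x r t + L := by
  classical
  unfold inn cnt
  calc _ ≤ (((Finset.Ico s r).filter (· ∈ badSet L x r) ∪
        (Finset.Ico r t).filter (· ∈ badSet L x t)) ∪ Finset.Ico (r - L) r).card := by
        apply Finset.card_le_card
        intro p hp
        simp only [Finset.mem_union, Finset.mem_filter, Finset.mem_Ico] at hp ⊢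
        obtain ⟨⟨h1, h2⟩, h3, h4⟩ := hp
        by_cases h5 : r ≤ p
        · exact Or.inl (Or.inr ⟨⟨h5, h2⟩, h3, h4⟩)
        by_cases h6 : p + L ≤ r
        · exact Or.inl (Or.inl ⟨⟨h1, by omega⟩, h6, h4⟩)
        · right; omega
    _ ≤ _ := by
        refine (Finset.card_union_le _ _).trans ?_
        have := Finset.card_union_le ((Finset.Ico s r).filter (· ∈ badSet L x r))
          ((Finset.Ico r t).filter (· ∈ badSet L x t))
        have h2 : (Finset.Ico (r - L) r).card ≤ L := by rw [Nat.card_Ico]; omega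
        omega

lemma inn_copy (L : ℕ) (x : ℕ → Fin k) (s t d : ℕ) (hL : 1 ≤ L)
    (h : ∀ i, s ≤ i → i < t → x (d + i) = x i) : inn L x (d + s) (d + t) ≤ inn L x s t := by
  classical
  unfold inn cnt
  apply Finset.card_le_card_of_injOn (fun p => p - d)
  · intro p hp
    simp only [SetLike.mem_coe, Finset.mem_filter, Finset.mem_Ico] at hp ⊢
    obtain ⟨⟨h1, h2⟩, h3, h4⟩ := hp
    refine ⟨by omega, by omega, fun j hj => ?_⟩
    rw [← h (p - d + j) (by omega) (by omega), ← h (p - d) (by omega) (by omega),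
      show d + (p - d + j) = p + j by omega, show d + (p - d) = p by omega]
    exact h4 j hj
  · intro p hp q hq hpq
    simp only [SetLike.mem_coe, Finset.mem_filter, Finset.mem_Ico] at hp hq hpq
    omega

lemma inn_zero (L : ℕ) (x v : ℕ → Fin k) (s t q : ℕ) (hv : v ∈ PiL k L) (hq : q ≤ s)
    (h : ∀ i, s ≤ i → i < t → x i = v (i - q)) : inn L x s t = 0 := by
  classical
  unfold inn cnt
  rw [Finset.card_eq_zero, Finset.filter_eq_empty_iff]
  intro p hp hb
  rw [Finset.mem_Ico] at hp
  obtain ⟨h1, h2⟩ := hb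
  obtain ⟨j₁, j₂, hj₁, hj₂, hne⟩ := hv (p - q)
  apply hne
  have e1 := h (p + j₁) (by omega) (by omega)
  have e2 := h (p + j₂) (by omega) (by omega)
  rw [show p - q + j₁ = p + j₁ - q by omega, show p - q + j₂ = p + j₂ - q by omega, ← e1, ← e2,
    h2 _ hj₁, h2 _ hj₂]

section
variable {L : ℕ} {x y : ℕ → Fin k} {a c : ℕ → ℕ}

lemma inn_block (h : Str L x y a c) (hy : y ∈ PiL k L) (n l s t : ℕ)
    (hs : a n + c n + l * (n + 1) ≤ s) (ht : t ≤ a n + c n + (l + 1) * (n + 1))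
    (ht2 : t ≤ a n + c n + a n ^ 2 * (n + 1)) : inn L x s t = 0 := by
  apply inn_zero L x y s t _ hy hs
  intro i hi1 hi2
  have e : (l + 1) * (n + 1) = l * (n + 1) + (n + 1) := by ring
  have hl : l < a n ^ 2 := by
    by_contra hl
    have := Nat.mul_le_mul_right (n + 1) (not_lt.1 hl)
    omega
  have := h.hY n l (i - (a n + c n + l * (n + 1))) hl (by omega)
  rw [← this]
  congr 1; omega

lemma inn_from (h : Str L x y a c) (hy : y ∈ PiL k L) (n t : ℕ) 
    (ht2 : t ≤ a n + c n + a n ^ 2 * (n + 1)) (e : ℕ) : ∀ l, a n + c n + l * (n + 1) ≤ t →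
    t < a n + c n + (l + e + 1) * (n + 1) → inn L x (a n + c n + l * (n + 1)) t ≤ L * e := by
  induction e with
  | zero =>
    intro l h1 h2
    rw [inn_block h hy n l _ t le_rfl (by simpa using h2.le) ht2]
    omega
  | succ e ih =>
    intro l h1 h2
    have e1 : (l + 1) * (n + 1) = l * (n + 1) + (n + 1) := by ring
    by_cases h3 : t ≤ a n + c n + (l + 1) * (n + 1)
    · rw [inn_block h hy n l _ t le_rfl h3 ht2]; omega
    · have h4 := inn_split L x (a n + c n + l * (n + 1)) (a n + c n + (l + 1) * (n + 1)) t
        (by omega) (by omega)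
      rw [inn_block h hy n l _ _ le_rfl le_rfl (by omega)] at h4
      have h5 := ih (l + 1) (by omega) (by convert h2 using 3; ring)
      have e3 : L * (e + 1) = L * e + L := by ring
      omega

lemma inn_B (h : Str L x y a c) (hy : y ∈ PiL k L) (n s t : ℕ) (hs : a n ≤ s) (hst : s ≤ t)
    (ht : t ≤ a n + (c n + a n ^ 2 * (n + 1))) :
    inn L x s t ≤ 3 * L + L * ((t - s) / (n + 1)) := by
  rw [← add_assoc] at ht
  -- Y part
  have key : ∀ s, a n + c n ≤ s → s ≤ t → inn L x s t ≤ L + L * ((t - s) / (n + 1)) := by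
    intro s hs hst
    obtain ⟨l, r, hr, hl⟩ : ∃ l r, r < n + 1 ∧ s - (a n + c n) = l * (n + 1) + r :=
      ⟨(s - (a n + c n)) / (n + 1), (s - (a n + c n)) % (n + 1), Nat.mod_lt _ (by omega),
        (Nat.div_add_mod' _ _).symm⟩
    have e1 : (l + 1) * (n + 1) = l * (n + 1) + (n + 1) := by ring
    by_cases h3 : t ≤ a n + c n + (l + 1) * (n + 1)
    · rw [inn_block h hy n l s t (by omega) h3 ht]; omega
    · have h4 := inn_split L x s (a n + c n + (l + 1) * (n + 1)) t (by omega) (by omega)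
      rw [inn_block h hy n l _ _ (by omega) le_rfl (by omega)] at h4
      have h5 := inn_from h hy n t ht ((t - s) / (n + 1)) (l + 1) (by omega) (by
        have h6 := Nat.div_add_mod' (t - s) (n + 1)
        have h7 := Nat.mod_lt (t - s) (show 0 < n + 1 by omega)
        have e2 : (l + 1 + (t - s) / (n + 1) + 1) * (n + 1) =
          (l + 1) * (n + 1) + (t - s) / (n + 1) * (n + 1) + (n + 1) := by ring
        omega)
      omega
  obtain ⟨v, hv, hCv⟩ := h.hC n
  have hz : ∀ t', t' ≤ a n + c n → inn L x s t' = 0 := by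
    intro t' ht'
    apply inn_zero L x v s t' (a n) hv hs
    intro i h1 h2
    rw [← hCv (i - a n) (by omega)]
    congr 1; omega
  by_cases h1 : t ≤ a n + c n
  · rw [hz t h1]; omega
  by_cases h2 : a n + c n ≤ s
  · have := key s h2 hst; omega
  · have h3 := inn_split L x s (a n + c n) t (by omega) (by omega)
    rw [hz _ le_rfl] at h3
    have h4 := key (a n + c n) le_rfl (by omega)
    have h5 : L * ((t - (a n + c n)) / (n + 1)) ≤ L * ((t - s) / (n + 1)) :=
      Nat.mul_le_mul_left _ (Nat.div_le_div_right (by omega))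
    omega

lemma inn_B' (h : Str L x y a c) (hy : y ∈ PiL k L) (δ : ℝ) (m n s t : ℕ) (hmn : m ≤ n)
    (hm : 2 + 15 * (L : ℝ) ≤ δ / 2 * (m + 1)) (hδ : 0 < δ) (hs : a n ≤ s) (hst : s ≤ t)
    (ht : t ≤ a n + (c n + a n ^ 2 * (n + 1))) :
    (inn L x s t : ℝ) ≤ 3 * L + δ / 2 * (t - s) := by
  have h1 : (inn L x s t : ℝ) ≤ 3 * L + L * (((t - s) / (n + 1) : ℕ) : ℝ) := by
    exact_mod_cast inn_B h hy n s t hs hst ht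
  have h2 : (((t - s) / (n + 1) : ℕ) : ℝ) ≤ ((t - s : ℕ) : ℝ) / ((n + 1 : ℕ) : ℝ) := Nat.cast_div_le
  rw [Nat.cast_sub hst] at h2
  push_cast at h2
  have hmn' : (m : ℝ) ≤ n := by exact_mod_cast hmn
  have h3 : (L : ℝ) ≤ δ / 2 * (n + 1) := by
    have : δ / 2 * (m + 1) ≤ δ / 2 * (n + 1) := by gcongr
    have : (0 : ℝ) ≤ L := by positivity
    linarith
  have hts : (0 : ℝ) ≤ t - s := by
    have : (s : ℝ) ≤ t := by exact_mod_cast hst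
    linarith
  have h4 : (L : ℝ) * (((t - s) / (n + 1) : ℕ) : ℝ) ≤ δ / 2 * (t - s) := by
    calc (L : ℝ) * (((t - s) / (n + 1) : ℕ) : ℝ) ≤ L * ((t - s) / (n + 1)) := by gcongr
      _ = L * (t - s) / (n + 1) := by ring
      _ ≤ δ / 2 * (t - s) := by
        rw [div_le_iff₀ (by positivity)]
        nlinarith
  linarith

lemma inn_main (h : Str L x y a c) (hy : y ∈ PiL k L) (hL : 1 ≤ L) (δ : ℝ) (hδ : 0 < δ) :
    ∃ K : ℝ, ∀ s t, s ≤ t → (inn L x s t : ℝ) ≤ δ * (t - s) + K := by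
  obtain ⟨m, hm⟩ : ∃ m : ℕ, 2 + 15 * (L : ℝ) ≤ δ / 2 * (m + 1) := by
    obtain ⟨m, hm⟩ := exists_nat_ge ((2 + 15 * (L : ℝ)) / (δ / 2))
    refine ⟨m, ?_⟩
    rw [div_le_iff₀ (by positivity)] at hm
    nlinarith
  have hL0 : (0 : ℝ) ≤ L := by positivity
  set b : ℕ → ℕ := fun n => c n + a n ^ 2 * (n + 1) with hb
  have as : ∀ n, a (n + 1) = a n + b n + a n := h.asucc
  have asR : ∀ n, (a (n + 1) : ℝ) = a n + b n + a n := fun n => by exact_mod_cast as n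
  have hB : ∀ n s t, m ≤ n → a n ≤ s → s ≤ t → t ≤ a n + b n →
      (inn L x s t : ℝ) ≤ 3 * L + δ / 2 * (t - s) := fun n s t h1 h2 h3 h4 =>
    inn_B' h hy δ m n s t h1 hm hδ h2 h3 h4
  have hsp : ∀ s r t, s ≤ r → r ≤ t → (inn L x s t : ℝ) ≤ inn L x s r + inn L x r t + L :=
    fun s r t h1 h2 => by exact_mod_cast inn_split L x s r t h1 h2
  have hcp : ∀ n s t, t ≤ a n → (inn L x (a n + b n + s) (a n + b n + t) : ℝ) ≤ inn L x s t :=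
    fun n s t h1 => by
      exact_mod_cast inn_copy L x s t (a n + b n) hL fun i hi hi' => h.hA n i (by omega)
  have hABA : ∀ n, m ≤ n →
      (inn L x 0 (a (n + 1)) : ℝ) ≤ 2 * inn L x 0 (a n) + 5 * L + δ / 2 * b n := by
    intro n hn
    have h1 := hsp 0 (a n) (a (n + 1)) (by omega) (by rw [as]; omega)
    have h2 := hsp (a n) (a n + b n) (a (n + 1)) (by omega) (by rw [as]; omega)
    have h3 := hB n (a n) (a n + b n) hn le_rfl (by omega) le_rfl
    have h4 := hcp n 0 (a n) le_rfl
    rw [add_zero, ← as] at h4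
    push_cast at h3
    linarith
  have full : ∀ n, m + 1 ≤ n → (inn L x 0 (a n) : ℝ) + 10 * L ≤ δ * a n := by
    intro n hn
    induction n, hn using Nat.le_induction with
    | base =>
      have h1 := hABA m le_rfl
      have h2 : (inn L x 0 (a m) : ℝ) ≤ a m := by exact_mod_cast inn_le L x 0 (a m)
      have h3 : (1 : ℝ) ≤ a m := by exact_mod_cast h.apos m
      have h4 : (a m : ℝ) ^ 2 * (m + 1) ≤ b m := by
        simp only [hb]; push_cast
        have : (0 : ℝ) ≤ c m := by positivity
        linarith
      rw [asR]
      have h5 : 2 * (a m : ℝ) + 15 * L ≤ δ / 2 * b m := by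
        calc 2 * (a m : ℝ) + 15 * L ≤ (2 + 15 * L) * a m := by nlinarith
          _ ≤ (2 + 15 * L) * a m ^ 2 := by gcongr; nlinarith
          _ ≤ (δ / 2 * (m + 1)) * a m ^ 2 := by gcongr
          _ = δ / 2 * (a m ^ 2 * (m + 1)) := by ring
          _ ≤ _ := by gcongr
      have : 0 ≤ δ * a m := by positivity
      nlinarith
    | succ n hn ih =>
      have h1 := hABA n (by omega)
      have : 0 ≤ δ * b n := by positivity
      rw [asR]
      nlinarith
  set K1 : ℝ := (a (m + 1) : ℝ) with hK1
  have hK10 : 0 ≤ K1 := by positivity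
  have pre : ∀ n, m + 1 ≤ n → ∀ t ≤ a n, (inn L x 0 t : ℝ) ≤ δ * t + K1 := by
    intro n hn
    induction n, hn using Nat.le_induction with
    | base =>
      intro t ht
      have h2 : (inn L x 0 t : ℝ) ≤ t := by exact_mod_cast inn_le L x 0 t
      have h3 : (t : ℝ) ≤ a (m + 1) := by exact_mod_cast ht
      have : 0 ≤ δ * t := by positivity
      linarith
    | succ n hn ih =>
      have hmid : ∀ t, a n ≤ t → t ≤ a n + b n → (inn L x 0 t : ℝ) ≤ δ * t - 6 * L := by
        intro t h1 h2
        have h3 := hsp 0 (a n) t (by omega) h1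
        have h4 := hB n (a n) t (by omega) le_rfl h1 h2
        have h5 := full n hn
        have h6 : (a n : ℝ) ≤ t := by exact_mod_cast h1
        nlinarith
      intro t ht
      rcases le_total t (a n) with h1 | h1
      · exact ih t h1
      rcases le_total t (a n + b n) with h2 | h2
      · have := hmid t h1 h2; linarith
      · obtain ⟨r, rfl⟩ := Nat.exists_eq_add_of_le h2
        have hr : r ≤ a n := by rw [as] at ht; omega
        have h3 := hsp 0 (a n + b n) (a n + b n + r) (by omega) h2
        have h4 := hcp n 0 r hr
        rw [add_zero] at h4
        have h5 := ih r hr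
        have h6 := hmid (a n + b n) (by omega) le_rfl
        push_cast at h6 ⊢
        linarith
  have suf : ∀ n, m + 1 ≤ n → ∀ s ≤ a n, (inn L x s (a n) : ℝ) ≤ δ * (a n - s) + K1 := by
    intro n hn
    induction n, hn using Nat.le_induction with
    | base =>
      intro s hs
      have h2 : (inn L x s (a (m + 1)) : ℝ) ≤ a (m + 1) := by
        exact_mod_cast (inn_le L x s _).trans (Nat.sub_le _ _)
      have h3 : (s : ℝ) ≤ a (m + 1) := by exact_mod_cast hs
      have : 0 ≤ δ * (a (m + 1) - s) := mul_nonneg hδ.le (by linarith)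
      linarith
    | succ n hn ih =>
      have hfc := hcp n 0 (a n) le_rfl
      rw [add_zero, ← as] at hfc
      have hmid : ∀ s, a n ≤ s → s ≤ a n + b n →
          (inn L x s (a (n + 1)) : ℝ) ≤ δ * (a (n + 1) - s) - 6 * L := by
        intro s h1 h2
        have h3 := hsp s (a n + b n) (a (n + 1)) h2 (by rw [as]; omega)
        have h4 := hB n s (a n + b n) (by omega) h1 h2 le_rfl
        have h5 := full n hn
        have h6 : (s : ℝ) ≤ a n + b n := by exact_mod_cast h2
        push_cast at h4
        rw [asR]
        nlinarith
      intro s hs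
      rcases le_total s (a n) with h1 | h1
      · have h3 := hsp s (a n) (a (n + 1)) h1 (by rw [as]; omega)
        have h4 := ih s h1
        have h5 := hmid (a n) le_rfl (by omega)
        linarith
      rcases le_total s (a n + b n) with h2 | h2
      · have := hmid s h1 h2; linarith
      · obtain ⟨r, rfl⟩ := Nat.exists_eq_add_of_le h2
        have hr : r ≤ a n := by rw [as] at hs; omega
        have h4 := hcp n r (a n) le_rfl
        rw [← as] at h4
        have h5 := ih r hr
        rw [asR]
        push_cast
        linarith
  refine ⟨2 * K1 + 5 * L, ?_⟩
  have win : ∀ n, m + 1 ≤ n → ∀ s t, s ≤ t → t ≤ a n →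
      (inn L x s t : ℝ) ≤ δ * (t - s) + (2 * K1 + 5 * L) := by
    intro n hn
    induction n, hn using Nat.le_induction with
    | base =>
      intro s t hst ht
      have h2 : (inn L x s t : ℝ) ≤ a (m + 1) := by
        exact_mod_cast (inn_le L x s t).trans (by omega)
      have h3 : (s : ℝ) ≤ t := by exact_mod_cast hst
      have : 0 ≤ δ * (t - s : ℝ) := mul_nonneg hδ.le (by linarith)
      linarith
    | succ n hn ih =>
      intro s t hst ht
      have hB2 : ∀ s t, a n ≤ s → s ≤ t → t ≤ a n + b n →
          (inn L x s t : ℝ) ≤ 3 * L + δ * (t - s) := by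
        intro s t h1 h2 h3
        have h4 := hB n s t (by omega) h1 h2 h3
        have h5 : (s : ℝ) ≤ t := by exact_mod_cast h2
        nlinarith
      have hright : ∀ r ≤ a n, (inn L x (a n + b n) (a n + b n + r) : ℝ) ≤ δ * r + K1 := by
        intro r hr
        have h4 := hcp n 0 r hr
        rw [add_zero] at h4
        have := pre n hn r hr
        linarith
      rcases le_total t (a n) with h1 | h1
      · exact ih s t hst h1
      rcases le_total t (a n + b n) with h2 | h2
      · rcases le_total s (a n) with h3 | h3
        · have := hsp s (a n) t h3 h1
          have := suf n hn s h3
          have := hB2 (a n) t le_rfl h1 h2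
          linarith
        · have := hB2 s t h3 hst h2
          linarith
      · obtain ⟨r, rfl⟩ := Nat.exists_eq_add_of_le h2
        have hr : r ≤ a n := by rw [as] at ht; omega
        have hR := hright r hr
        rcases le_total (a n + b n) s with h3 | h3
        · obtain ⟨q, rfl⟩ := Nat.exists_eq_add_of_le h3
          have h4 := hcp n q r hr
          have h5 := ih q r (by omega) hr
          push_cast
          linarith
        have h4 := hsp s (a n + b n) (a n + b n + r) h3 h2
        rcases le_total s (a n) with h5 | h5
        · have := hsp s (a n) (a n + b n) h5 (by omega)
          have := suf n hn s h5
          have := hB2 (a n) (a n + b n) le_rfl (by omega) le_rfl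
          push_cast at this ⊢
          linarith
        · have := hB2 s (a n + b n) h5 h3 le_rfl
          push_cast at this ⊢
          linarith
  have ha : ∀ n, n + 1 ≤ a n := by
    intro n
    induction n with
    | zero => exact h.apos 0
    | succ n ih => rw [h.asucc]; omega
  intro s t hst
  exact win (m + 1 + t) (by omega) s t hst (by have := ha (m + 1 + t); omega)

lemma bupper_sub (h : Str L x y a c) (hy : y ∈ PiL k L) (hL : 1 ≤ L) :
    statOmega banachUpperDensity x ⊆ PiL k L := by
  classical
  intro z hz
  rw [statOmega_iff bupper_mono] at hz
  by_contra hnot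
  obtain ⟨i, hi⟩ : ∃ i, ∀ j₁ j₂, j₁ < L → j₂ < L → z (i + j₁) = z (i + j₂) := by
    by_contra hcon
    apply hnot
    intro i
    by_contra h2
    apply hcon
    refine ⟨i, fun j₁ j₂ h₁ h₂ => ?_⟩
    by_contra h3
    exact h2 ⟨j₁, j₂, h₁, h₂, h3⟩
  have h0 := hz (i + L)
  rw [bupper_eq] at h0
  set S := occ x z (i + L)
  set d := limsup (fun N : ℕ => ⨆ a : ℕ, ((cnt S a (a + N) : ℕ) : ℝ) / N) atTop with hd
  obtain ⟨K, hK⟩ := inn_main h hy hL (d / 4) (by linarith)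
  have hcount : ∀ p N, cnt S p (p + N) ≤ inn L x (i + p) (i + (p + N) + L) := by
    intro p N
    unfold inn cnt
    apply Finset.card_le_card_of_injOn (fun q => i + q)
    · intro q hq
      simp only [SetLike.mem_coe, Finset.mem_filter, Finset.mem_Ico] at hq ⊢
      obtain ⟨⟨h1, h2⟩, h3, h4⟩ := hq
      refine ⟨by omega, by omega, fun j hj => ?_⟩
      have e1 := h4 (i + j) (by omega)
      have e2 := h4 i (by omega)
      rw [show i + q + j = q + (i + j) by ring, show i + q = q + i by ring, e1, e2]
      exact hi j 0 hj (by omega)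
    · intro q hq q' hq' hqq
      simpa using hqq
  have hev : ∀ᶠ N : ℕ in atTop, (⨆ a : ℕ, ((cnt S a (a + N) : ℕ) : ℝ) / N) ≤ d / 2 := by
    obtain ⟨N0, hN0⟩ := exists_nat_ge ((d / 4 * L + K) / (d / 4))
    rw [div_le_iff₀ (by linarith)] at hN0
    filter_upwards [eventually_ge_atTop (N0 + 1)] with N hN
    apply ciSup_le
    intro p
    have hNR : (N0 : ℝ) + 1 ≤ N := by exact_mod_cast hN
    have hNp : (0 : ℝ) < N := by
      have : (0 : ℝ) ≤ N0 := by positivity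
      linarith
    rw [div_le_iff₀ hNp]
    have h1 : (cnt S p (p + N) : ℝ) ≤ inn L x (i + p) (i + (p + N) + L) := by
      exact_mod_cast hcount p N
    have h2 := hK (i + p) (i + (p + N) + L) (by omega)
    push_cast at h2
    nlinarith
  have : d ≤ d / 2 := limsup_le_of_le
    (isBoundedUnder_of ⟨0, fun n => (bsup_bd S n).1⟩ :
      IsBoundedUnder (· ≥ ·) atTop _).isCoboundedUnder_le hev
  linarith

/-! ordinary densities -/

lemma cnt_close_one (S S' : Set ℕ) (d e N m : ℕ)
    (h : ∀ i < N, 1 ≤ i → i + m ≤ N → d + i ∈ S → e + i ∈ S') :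
    cnt S d (d + N) ≤ cnt S' e (e + N) + (m + 1) := by
  classical
  unfold cnt
  calc _ ≤ (((Finset.Ico e (e + N)).filter (· ∈ S')).image (fun q => q - e + d) ∪
        ({d} ∪ Finset.Ico (d + N - m) (d + N))).card := by
        apply Finset.card_le_card
        intro p hp
        simp only [Finset.mem_union, Finset.mem_filter, Finset.mem_Ico, Finset.mem_image,
          Finset.mem_singleton] at hp ⊢
        obtain ⟨⟨h1, h2⟩, h3⟩ := hp
        by_cases h4 : p = d
        · exact Or.inr (Or.inl h4)
        by_cases h5 : p - d + m ≤ N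
        · left
          refine ⟨e + (p - d), ⟨by omega, h (p - d) (by omega) (by omega) h5 ?_⟩, by omega⟩
          rwa [show d + (p - d) = p by omega]
        · right; right; omega
    _ ≤ _ := by
        refine (Finset.card_union_le _ _).trans ?_
        have h1 := Finset.card_image_le (s := (Finset.Ico e (e + N)).filter (· ∈ S'))
          (f := fun q => q - e + d)
        have h2 := Finset.card_union_le ({d} : Finset ℕ) (Finset.Ico (d + N - m) (d + N))
        have h3 : (Finset.Ico (d + N - m) (d + N)).card ≤ m := by rw [Nat.card_Ico]; omega
        rw [Finset.card_singleton] at h2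
        omega

lemma block_cnt (h : Str L x y a c) (z : ℕ → Fin k) (m n j : ℕ) (hj : j < a n ^ 2) :
    |(cnt (occ x z m) (a n + c n + j * (n + 1)) (a n + c n + j * (n + 1) + (n + 1)) : ℝ) -
      cnt (occ y z m) 0 (n + 1)| ≤ m + 1 := by
  have hpos := h.apos n
  have e : ∀ i, 1 ≤ i → i + m ≤ n + 1 →
      (a n + c n + j * (n + 1) + i ∈ occ x z m ↔ 0 + i ∈ occ y z m) := by
    intro i hi him
    have : ∀ l < m, x (a n + c n + j * (n + 1) + i + l) = y (0 + i + l) := by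
      intro l hl
      rw [add_assoc _ i l, h.hY n j (i + l) hj (by omega), zero_add]
    constructor
    · rintro ⟨h1, h2⟩
      exact ⟨by omega, fun l hl => by rw [← this l hl, h2 l hl]⟩
    · rintro ⟨h1, h2⟩
      exact ⟨by omega, fun l hl => by rw [this l hl, h2 l hl]⟩
  have h1 := cnt_close_one (occ x z m) (occ y z m) (a n + c n + j * (n + 1)) 0 (n + 1) m
    (fun i _ h1 h2 => (e i h1 h2).1)
  have h2 := cnt_close_one (occ y z m) (occ x z m) 0 (a n + c n + j * (n + 1)) (n + 1) m
    (fun i _ h1 h2 => (e i h1 h2).2)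
  rw [zero_add] at h1 h2
  have h1' : (cnt (occ x z m) (a n + c n + j * (n + 1)) (a n + c n + j * (n + 1) + (n + 1)) : ℝ) ≤
      cnt (occ y z m) 0 (n + 1) + (m + 1) := by exact_mod_cast h1
  have h2' : (cnt (occ y z m) 0 (n + 1) : ℝ) ≤
      cnt (occ x z m) (a n + c n + j * (n + 1)) (a n + c n + j * (n + 1) + (n + 1)) + (m + 1) := by
    exact_mod_cast h2
  rw [abs_le]; constructor <;> linarith

noncomputable def ee (S : Set ℕ) (f : ℝ) (s t : ℕ) : ℝ := (cnt S s t : ℝ) - f * ((t : ℝ) - s)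

lemma ee_add (S : Set ℕ) (f : ℝ) {s r t : ℕ} (h1 : s ≤ r) (h2 : r ≤ t) :
    ee S f s t = ee S f s r + ee S f r t := by
  unfold ee
  rw [cnt_add S h1 h2]; push_cast; ring

lemma ee_tri (S : Set ℕ) (f : ℝ) {s r t : ℕ} (h1 : s ≤ r) (h2 : r ≤ t) :
    |ee S f s t| ≤ |ee S f s r| + |ee S f r t| := by
  rw [ee_add S f h1 h2]; exact abs_add_le _ _

lemma ee_le (S : Set ℕ) {f : ℝ} (hf : 0 ≤ f ∧ f ≤ 1) {s t : ℕ} (h : s ≤ t) :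
    |ee S f s t| ≤ (t : ℝ) - s := by
  unfold ee
  have h1 : (cnt S s t : ℝ) ≤ (t : ℝ) - s := by
    rw [← Nat.cast_sub h]; exact_mod_cast cnt_le S s t
  have h2 : (0 : ℝ) ≤ cnt S s t := by positivity
  have h3 : (0 : ℝ) ≤ (t : ℝ) - s := h2.trans h1
  rw [abs_le]; constructor <;> nlinarith

lemma ee_Y (h : Str L x y a c) (z : ℕ → Fin k) (m n J : ℕ) (hJ : J ≤ a n ^ 2) :
    |ee (occ x z m) ((cnt (occ y z m) 0 (n + 1) : ℝ) / ((n + 1 : ℕ) : ℝ)) (a n + c n)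
      (a n + c n + J * (n + 1))| ≤ J * (m + 1) := by
  induction J with
  | zero => simp [ee, cnt]
  | succ J ih =>
    have h1 := ih (by omega)
    have h2 := block_cnt h z m n J (by omega)
    have e1 : a n + c n + (J + 1) * (n + 1) = a n + c n + J * (n + 1) + (n + 1) := by ring
    rw [e1]
    refine (ee_tri _ _ (r := a n + c n + J * (n + 1)) (by omega) (by omega)).trans ?_
    have h3 : |ee (occ x z m) ((cnt (occ y z m) 0 (n + 1) : ℝ) / ((n + 1 : ℕ) : ℝ))
        (a n + c n + J * (n + 1)) (a n + c n + J * (n + 1) + (n + 1))| ≤ m + 1 := by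
      convert h2 using 2
      unfold ee
      push_cast
      field_simp
      ring
    have e3 : ((J + 1 : ℕ) : ℝ) * (m + 1) = J * (m + 1) + (m + 1) := by push_cast; ring
    rw [e3]
    exact add_le_add h1 h3

lemma tend_inv (C : ℝ) : Tendsto (fun n : ℕ => C / ((n : ℝ) + 1)) atTop (𝓝 0) := by
  have := (tendsto_one_div_add_atTop_nhds_zero_nat (𝕜 := ℝ)).const_mul C
  simpa only [mul_one_div, mul_zero] using this

lemma dens (h : Str L x y a c) (hsm : Tendsto (fun n => (c n : ℝ) / a n) atTop (𝓝 0))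
    (z : ℕ → Fin k) (m : ℕ) :
    upperDensity (occ x z m) = upperDensity (occ y z m) ∧
    lowerDensity (occ x z m) = lowerDensity (occ y z m) := by
  set S := occ x z m with hS
  set H := occ y z m with hH
  set f : ℕ → ℝ := fun n => (cnt H 0 n : ℝ) / n with hf
  set g : ℕ → ℝ := fun n => (cnt S 0 n : ℝ) / n with hg
  have hf01 : ∀ n, 0 ≤ f n ∧ f n ≤ 1 := ratio_bd0 H
  have hg01 : ∀ n, 0 ≤ g n ∧ g n ≤ 1 := ratio_bd0 S
  have ha1 : ∀ n, n + 1 ≤ a n := by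
    intro n
    induction n with
    | zero => exact h.apos 0
    | succ n ih => rw [h.asucc]; omega
  have ha0 : ∀ n, (0 : ℝ) < a n := fun n => by exact_mod_cast (h.apos n)
  have ha0' : ∀ n, (1 : ℝ) ≤ a n := fun n => by exact_mod_cast (h.apos n)
  have hmono : ∀ n, a n ≤ a (n + 1) := fun n => by rw [h.asucc]; omega
  have hmon : Monotone a := monotone_nat_of_le_succ hmono
  have hY : ∀ n J, J ≤ a n ^ 2 → |ee S (f (n + 1)) (a n + c n) (a n + c n + J * (n + 1))|
      ≤ J * (m + 1) := fun n J hJ => ee_Y h z m n J hJ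
  have asR : ∀ n, (a (n + 1) : ℝ) = a n + (c n + a n ^ 2 * (n + 1)) + a n :=
    fun n => by exact_mod_cast h.asucc n
  -- relation of ee and g
  have heg : ∀ N n : ℕ, 1 ≤ N → |g N - f n| = |ee S (f n) 0 N| / N := by
    intro N n hN
    have hN' : (0 : ℝ) < N := by exact_mod_cast hN
    rw [← abs_of_pos hN', ← abs_div]
    congr 1
    simp only [hg, ee]
    field_simp
    simp only [Nat.cast_zero, sub_zero]
    ring
  have hfirst : ∀ n, |ee S (f (n + 1)) 0 (a n + c n)| ≤ |ee S (f (n + 1)) 0 (a n)| + c n := by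
    intro n
    have h1 := ee_tri S (f (n + 1)) (s := 0) (r := a n) (t := a n + c n) (by omega) (by omega)
    have h2 := ee_le S (hf01 (n + 1)) (s := a n) (t := a n + c n) (by omega)
    push_cast at h2
    linarith
  have hYfull : ∀ n, |ee S (f (n + 1)) 0 (a n + (c n + a n ^ 2 * (n + 1)))| ≤
      |ee S (f (n + 1)) 0 (a n)| + c n + a n ^ 2 * (m + 1) := by
    intro n
    rw [← add_assoc]
    have h1 := ee_tri S (f (n + 1)) (s := 0) (r := a n + c n)
      (t := a n + c n + a n ^ 2 * (n + 1)) (by omega) (by omega)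
    have h2 := hY n _ le_rfl
    have h3 := hfirst n
    push_cast at h2
    linarith
  have hend : ∀ n, |ee S (f (n + 1)) 0 (a (n + 1))| ≤ 2 * a n + c n + a n ^ 2 * (m + 1) := by
    intro n
    have h1 := ee_tri S (f (n + 1)) (s := 0) (r := a n + (c n + a n ^ 2 * (n + 1)))
      (t := a (n + 1)) (by omega) (by rw [h.asucc]; omega)
    have h2 := hYfull n
    have h3 := ee_le S (hf01 (n + 1)) (s := 0) (t := a n) (by omega)
    have h4 := ee_le S (hf01 (n + 1)) (s := a n + (c n + a n ^ 2 * (n + 1))) (t := a (n + 1))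
      (by rw [h.asucc]; omega)
    rw [asR] at h4
    push_cast at h3 h4
    linarith
  have t1 : Tendsto (fun n => |g (a n) - f n|) atTop (𝓝 0) := by
    rw [← tendsto_add_atTop_iff_nat 1]
    refine squeeze_zero' (Eventually.of_forall fun n => abs_nonneg _) ?_ (tend_inv (m + 4))
    filter_upwards [hsm.eventually (gt_mem_nhds (show (0 : ℝ) < 1 by norm_num))] with n hn
    rw [div_lt_one (ha0 n)] at hn
    rw [heg _ _ (h.apos _), div_le_div_iff₀ (ha0 _) (by positivity)]
    have h1 := hend n
    have h2 : 2 * (a n : ℝ) + c n + a n ^ 2 * (m + 1) ≤ (m + 4) * a n ^ 2 := by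
      nlinarith [ha0' n]
    have h3 : (a n : ℝ) ^ 2 * (n + 1) ≤ a (n + 1) := by
      rw [asR]
      have := ha0 n
      have : (0 : ℝ) ≤ c n := by positivity
      linarith
    calc _ ≤ ((m + 4) * (a n : ℝ) ^ 2) * (n + 1) := by gcongr; linarith
      _ = (m + 4) * ((a n : ℝ) ^ 2 * (n + 1)) := by ring
      _ ≤ _ := by gcongr
  have t2 : Tendsto (fun n => |f n - f (n + 1)|) atTop (𝓝 0) := by
    refine squeeze_zero' (Eventually.of_forall fun n => abs_nonneg _) ?_ (tend_inv 1)
    filter_upwards [eventually_ge_atTop 1] with n hn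
    have hn' : (0 : ℝ) < n := by exact_mod_cast hn
    have h1 := cnt_add H (a := 0) (b := n) (c := n + 1) (by omega) (by omega)
    have h2 := cnt_le H n (n + 1)
    have h3 : (cnt H n (n + 1) : ℝ) ≤ 1 := by exact_mod_cast (by omega)
    have h3' : (0 : ℝ) ≤ cnt H n (n + 1) := by positivity
    have h4 : f n - f (n + 1) = (f n - cnt H n (n + 1)) / (n + 1) := by
      simp only [hf, h1]
      push_cast
      field_simp
      ring
    rw [h4, abs_div, abs_of_pos (show (0 : ℝ) < n + 1 by positivity)]
    gcongr
    have := hf01 n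
    rw [abs_le]; constructor <;> linarith
  have t3 : Tendsto (fun n : ℕ => ((n : ℝ) + 1) / a n) atTop (𝓝 0) := by
    rw [← tendsto_add_atTop_iff_nat 1]
    refine squeeze_zero' (Eventually.of_forall fun n => by positivity) ?_ (tend_inv 2)
    refine Eventually.of_forall fun n => ?_
    rw [div_le_div_iff₀ (ha0 _) (by positivity)]
    have h3 : (a n : ℝ) ^ 2 * (n + 1) ≤ a (n + 1) := by
      rw [asR]
      have := ha0 n
      have : (0 : ℝ) ≤ c n := by positivity
      linarith
    have h4 : (n : ℝ) + 1 ≤ a n := by exact_mod_cast ha1 n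
    have h5 : ((n : ℝ) + 1) ≤ a n ^ 2 := by nlinarith [ha0' n]
    push_cast
    have h6 : ((n : ℝ) + 1) * (n + 1) ≤ a n ^ 2 * (n + 1) := by gcongr
    have h7 : (0 : ℝ) ≤ n := by positivity
    nlinarith
  set E : ℕ → ℝ := fun n => (|g (a n) - f n| + |f n - f (n + 1)|) + c n / a n +
    (m + 1) / ((n : ℝ) + 1) + (n + 1) / a n + 1 / ((n : ℝ) + 1) with hE
  have tE : Tendsto E atTop (𝓝 0) := by
    have := ((((t1.add t2).add hsm).add (tend_inv (m + 1))).add t3).add (tend_inv 1)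
    simpa only [add_zero] using this
  have hmain : ∀ n N, a n ≤ N → N < a (n + 1) → |g N - f (n + 1)| ≤ E n := by
    intro n N h1 h2
    have hN1 : 1 ≤ N := (h.apos n).trans h1
    have hN0 : (0 : ℝ) < N := by exact_mod_cast hN1
    have hNa : (a n : ℝ) ≤ N := by exact_mod_cast h1
    rw [heg N _ hN1, div_le_iff₀ hN0]
    set e0 := |ee S (f (n + 1)) 0 (a n)| with he0
    have b0 : e0 ≤ (|g (a n) - f n| + |f n - f (n + 1)|) * N := by
      have h3 : e0 = |g (a n) - f (n + 1)| * a n := by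
        rw [heg _ _ (h.apos n), div_mul_cancel₀ _ (ha0 n).ne']
      have h4 : |g (a n) - f (n + 1)| ≤ |g (a n) - f n| + |f n - f (n + 1)| := abs_sub_le _ _ _
      rw [h3]; gcongr
    have b1 : (c n : ℝ) ≤ c n / a n * N := by
      rw [div_mul_eq_mul_div, le_div_iff₀ (ha0 n)]; gcongr
    have b3 : (n : ℝ) + 1 ≤ (n + 1) / a n * N := by
      rw [div_mul_eq_mul_div, le_div_iff₀ (ha0 n)]; gcongr
    have b2 : ∀ J : ℕ, J * (n + 1) ≤ N → (J : ℝ) * (m + 1) ≤ (m + 1) / ((n : ℝ) + 1) * N := by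
      intro J hJ
      rw [div_mul_eq_mul_div, le_div_iff₀ (by positivity)]
      have : (J : ℝ) * (n + 1) ≤ N := by exact_mod_cast hJ
      have : (m + 1 : ℝ) * (J * (n + 1)) ≤ (m + 1) * N := by gcongr
      linarith
    have b2' : (0 : ℝ) ≤ (m + 1) / ((n : ℝ) + 1) * N := by positivity
    have b3' : (0 : ℝ) ≤ (n + 1) / a n * N := by positivity
    have b4' : (0 : ℝ) ≤ 1 / ((n : ℝ) + 1) * N := by positivity
    have hEN : E n * N = (|g (a n) - f n| + |f n - f (n + 1)|) * N + c n / a n * N +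
      (m + 1) / ((n : ℝ) + 1) * N + (n + 1) / a n * N + 1 / ((n : ℝ) + 1) * N := by
      simp only [hE]; ring
    rw [hEN]
    rcases le_total N (a n + c n) with h3 | h3
    · have h4 := ee_tri S (f (n + 1)) (s := 0) (r := a n) (t := N) (by omega) h1
      have h5 := ee_le S (hf01 (n + 1)) h1
      have h6 : (N : ℝ) ≤ a n + c n := by exact_mod_cast h3
      linarith
    rcases lt_or_ge N (a n + (c n + a n ^ 2 * (n + 1))) with h4 | h4
    · obtain ⟨J, r, hr, hJ⟩ : ∃ J r, r < n + 1 ∧ N - (a n + c n) = J * (n + 1) + r :=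
        ⟨(N - (a n + c n)) / (n + 1), (N - (a n + c n)) % (n + 1), Nat.mod_lt _ (by omega),
          (Nat.div_add_mod' _ _).symm⟩
      have hJ2 : J ≤ a n ^ 2 := by
        by_contra hc
        have := Nat.mul_le_mul_right (n + 1) (not_le.1 hc).le
        omega
      have h5 := ee_tri S (f (n + 1)) (s := 0) (r := a n + c n + J * (n + 1)) (t := N) (by omega)
        (by omega)
      have h6 := ee_tri S (f (n + 1)) (s := 0) (r := a n + c n) (t := a n + c n + J * (n + 1))
        (by omega) (by omega)
      have h7 := hfirst n
      have h8 := hY n J hJ2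
      have h9 := ee_le S (hf01 (n + 1)) (s := a n + c n + J * (n + 1)) (t := N) (by omega)
      have h10 := b2 J (by omega)
      have h11 : (N : ℝ) - ((a n + c n + J * (n + 1) : ℕ) : ℝ) ≤ n + 1 := by
        rw [← Nat.cast_sub (by omega)]
        exact_mod_cast (by omega)
      linarith
    · have h5 := ee_tri S (f (n + 1)) (s := 0) (r := a n + (c n + a n ^ 2 * (n + 1))) (t := N)
        (by omega) h4
      have h6 := hYfull n
      have h7 := ee_le S (hf01 (n + 1)) h4
      have h8 : (N : ℝ) - ((a n + (c n + a n ^ 2 * (n + 1)) : ℕ) : ℝ) ≤ a n := by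
        rw [← Nat.cast_sub h4]
        rw [h.asucc] at h2
        exact_mod_cast (by omega)
      have h9 := b2 (a n ^ 2) (by omega)
      push_cast at h9
      have h10 : (a n : ℝ) ≤ 1 / ((n : ℝ) + 1) * N := by
        rw [div_mul_eq_mul_div, le_div_iff₀ (by positivity)]
        have h11 : (a n : ℝ) ^ 2 * (n + 1) ≤ N := by exact_mod_cast (by omega)
        have h12 : (a n : ℝ) ≤ a n ^ 2 := by nlinarith [ha0' n]
        have h13 : (a n : ℝ) * (n + 1) ≤ a n ^ 2 * (n + 1) := by gcongr
        linarith
      linarith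
  -- the index map
  set ν : ℕ → ℕ := fun N => Nat.findGreatest (fun n => a n ≤ N) N with hν
  have hνspec : ∀ N, a 0 ≤ N → a (ν N) ≤ N ∧ N < a (ν N + 1) := by
    intro N hN
    refine ⟨Nat.findGreatest_spec (P := fun n => a n ≤ N) (Nat.zero_le N) hN, ?_⟩
    by_contra hc
    have hle : ν N + 1 ≤ N := by have := ha1 (ν N + 1); omega
    exact Nat.findGreatest_is_greatest (P := fun n => a n ≤ N) (k := ν N + 1) (n := N)
      (Nat.lt_succ_self _) hle (not_lt.1 hc)
  have hνt : Tendsto ν atTop atTop := by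
    rw [tendsto_atTop]
    intro M
    filter_upwards [eventually_ge_atTop (a M)] with N hN
    have hM := ha1 M
    exact Nat.le_findGreatest (P := fun n => a n ≤ N) (by omega) hN
  have hat : Tendsto a atTop atTop :=
    tendsto_atTop_mono (fun n => (Nat.le_succ n).trans (ha1 n)) tendsto_id
  have r1 : Tendsto (fun N => g N - f (ν N + 1)) atTop (𝓝 0) := by
    apply squeeze_zero_norm' _ (tE.comp hνt)
    filter_upwards [eventually_ge_atTop (a 0)] with N hN
    exact hmain _ _ (hνspec N hN).1 (hνspec N hN).2
  have r2 : Tendsto (fun n => f n - g (a n)) atTop (𝓝 0) := by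
    apply squeeze_zero_norm' _ t1
    exact Eventually.of_forall fun n => by rw [Real.norm_eq_abs, abs_sub_comm]
  have q1 := lim_transfer hg01 hf01 (φ := fun N => ν N + 1)
    (tendsto_atTop_mono (fun n => Nat.le_succ _) hνt) r1
  have q2 := lim_transfer hf01 hg01 hat r2
  rw [upper_eq, upper_eq, lower_eq, lower_eq]
  exact ⟨le_antisymm q1.1 q2.1, le_antisymm q2.2 q1.2⟩
end

lemma bupper_sub_y {L : ℕ} (y : ℕ → Fin k) (hy : y ∈ PiL k L) :
    statOmega banachUpperDensity y ⊆ PiL k L := by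
  intro z hz i
  rw [statOmega_iff bupper_mono] at hz
  have h0 := hz (i + L)
  have hne : (occ y z (i + L)).Nonempty := by
    by_contra hc
    rw [Set.not_nonempty_iff_eq_empty] at hc
    rw [hc, bupper_eq] at h0
    simp [cnt] at h0
  obtain ⟨p, -, hp⟩ := hne
  obtain ⟨j₁, j₂, h₁, h₂, hn⟩ := hy (p + i)
  refine ⟨j₁, j₂, h₁, h₂, ?_⟩
  rw [← hp _ (by omega), ← hp _ (by omega), ← add_assoc, ← add_assoc]
  exact hn
end aux

/-- **Lemma.** For the map `T` constructed from the proper subshift `Π_L` and a transitive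
point `y` of `Π_L`, one has `ω_ξ(T(y)) = ω_ξ(y)` for `ξ ∈ {d̄, d̲, B*, B_*}` and moreover
`ω_σ(y) = Π_L ⊊ ω_σ(T(y))`. -/
theorem T_preserves_statOmega_of_transitive (k L : ℕ) (hk : 2 ≤ k) (hL : 3 ≤ L)
    (D : TData k (PiL k L)) (hD : D.Small)
    (y : ℕ → Fin k) (hy : y ∈ PiL k L) (htrans : omegaLim y = PiL k L) :
    statOmega upperDensity (D.T y) = statOmega upperDensity y ∧
    statOmega lowerDensity (D.T y) = statOmega lowerDensity y ∧
    statOmega banachUpperDensity (D.T y) = statOmega banachUpperDensity y ∧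
    statOmega banachLowerDensity (D.T y) = statOmega banachLowerDensity y ∧
    PiL k L ⊂ omegaLim (D.T y) := by
  have hs := T_str D y
  have hx := T_omega D y
  have hyo : PiL k L ⊆ omegaLim y := htrans.ge
  refine ⟨?_, ?_, ?_, ?_, hx⟩
  · ext z
    rw [statOmega_iff upper_mono, statOmega_iff upper_mono]
    simp only [(dens hs (hD y) z _).1]
  · ext z
    rw [statOmega_iff lower_mono, statOmega_iff lower_mono]
    simp only [(dens hs (hD y) z _).2]
  · rw [Set.Subset.antisymm (bupper_sub hs hy (by omega)) (PiL_subset_bupper hk hL _ hx.1),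
      Set.Subset.antisymm (bupper_sub_y y hy) (PiL_subset_bupper hk hL _ hyo)]
  · rw [blower_empty hk hL _ hx.1, blower_empty hk hL _ hyo]
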